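/- Let f ∈ 𝒦 have radius of convergence R > 0, Khinchin family (X_t) and fulcrum F. Then for every t = e^s ∈ (0,R) and every integer n ≥ 3, E(X̆_t^n) = Σ_{(m₂,…,m_n)} n!/(m₂!⋯m_n!) · ∏_{j=2}^{n} ( F^{(j)}(s)/(F″(s)^{j/2} · j!) )^{m_j}, where the sum runs over all tuples of non-negative integers (m₂,…,m_n) with 2m₂ + 3m₃ + ⋯ + n·m_n = n. -/

import Mathlib

open scoped BigOperators Topology
open Filter

namespace KhinchinPaper

/-- Sum of the power series with coefficients `a` at `t`. -/
noncomputable def fsum (a : ℕ → ℝ) (t : ℝ) : ℝ := ∑' n : ℕ, a n * t ^ n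

/-- The class `𝒦`: non-constant power series with non-negative coefficients, `a 0 > 0`,
and radius of convergence `R > 0`. -/
structure IsK (a : ℕ → ℝ) (R : ℝ) : Prop where
  pos₀ : 0 < a 0
  nonneg : ∀ n, 0 ≤ a n
  nonconst : ∃ n, 0 < n ∧ 0 < a n
  Rpos : 0 < R
  conv : ∀ t : ℝ, 0 ≤ t → t < R → Summable fun n : ℕ => a n * t ^ n
  radius : ∀ t : ℝ, R < t → ¬ Summable fun n : ℕ => a n * t ^ n

/-- Mean function `m_f(t) = t f'(t)/f(t)`. -/
noncomputable def mf (a : ℕ → ℝ) (t : ℝ) : ℝ :=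
  (∑' n : ℕ, (n : ℝ) * a n * t ^ n) / fsum a t

/-- Variance function `σ_f²(t)`. -/
noncomputable def sigma2 (a : ℕ → ℝ) (t : ℝ) : ℝ :=
  (∑' n : ℕ, (n : ℝ) ^ 2 * a n * t ^ n) / fsum a t - (mf a t) ^ 2

noncomputable def sigma (a : ℕ → ℝ) (t : ℝ) : ℝ := Real.sqrt (sigma2 a t)

/-- `k`-th moment of the normalized Khinchin family variable `X̆_t`. -/
noncomputable def normMoment (a : ℕ → ℝ) (t : ℝ) (k : ℕ) : ℝ :=
  ∑' n : ℕ, (a n * t ^ n / fsum a t) * (((n : ℝ) - mf a t) / sigma a t) ^ k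

/-- `k`-th central moment of `X_t`. -/
noncomputable def centralMoment (a : ℕ → ℝ) (t : ℝ) (k : ℕ) : ℝ :=
  ∑' n : ℕ, (a n * t ^ n / fsum a t) * ((n : ℝ) - mf a t) ^ k

/-- Characteristic function `E(e^{iθ X̆_t})` of the normalized variable. -/
noncomputable def charfun (a : ℕ → ℝ) (t θ : ℝ) : ℂ :=
  ∑' n : ℕ, ((a n * t ^ n / fsum a t : ℝ) : ℂ) *
    Complex.exp (Complex.I * (θ : ℂ) * ((((n : ℝ) - mf a t) / sigma a t : ℝ) : ℂ))

/-- `f` is Gaussian: `X̆_t → N(0,1)` in distribution as `t ↑ R`, expressed via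
pointwise convergence of characteristic functions (Lévy's continuity theorem). -/
def IsGaussian (a : ℕ → ℝ) (R : ℝ) : Prop :=
  ∀ θ : ℝ, Tendsto (fun t => charfun a t θ) (𝓝[<] R)
    (𝓝 (Complex.exp (-(θ : ℂ) ^ 2 / 2)))

/-- Gaussian for entire `f` (radius `R = ∞`, so `t → +∞`). -/
def IsGaussianEntire (a : ℕ → ℝ) : Prop :=
  ∀ θ : ℝ, Tendsto (fun t => charfun a t θ) atTop
    (𝓝 (Complex.exp (-(θ : ℂ) ^ 2 / 2)))

/-- The fulcrum `F(s) = log f(e^s)` restricted to the real axis. -/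
noncomputable def fulcrum (a : ℕ → ℝ) (s : ℝ) : ℝ := Real.log (fsum a (Real.exp s))

/-- The quotient `F^{(j)}(s) / F''(s)^{j/2}`. -/
noncomputable def Fq (a : ℕ → ℝ) (j : ℕ) (s : ℝ) : ℝ :=
  iteratedDeriv j (fulcrum a) s / (iteratedDeriv 2 (fulcrum a) s) ^ ((j : ℝ) / 2)

/-- Tuples `(m₂, …, m_n)` of non-negative integers with `2m₂ + ⋯ + n m_n = n`,
padded with `m₀ = m₁ = 0` and encoded as functions on `Fin (n+1)`. -/
def tuples (n : ℕ) : Finset (Fin (n + 1) → ℕ) :=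
  (Fintype.piFinset fun _ : Fin (n + 1) => Finset.range (n + 1)).filter
    fun m => m 0 = 0 ∧ m 1 = 0 ∧ ∑ j : Fin (n + 1), (j : ℕ) * m j = n

/-- Integer moments of a standard normal random variable `Z`. -/
noncomputable def gaussMoment (k : ℕ) : ℝ :=
  if Even k then (Nat.factorial k : ℝ) / ((Nat.factorial (k / 2) : ℝ) * 2 ^ (k / 2)) else 0

/-- The complex power series sum. -/
noncomputable def fsumC (a : ℕ → ℝ) (z : ℂ) : ℂ := ∑' n : ℕ, (a n : ℂ) * z ^ n

/-- The complex fulcrum `F(z) = log f(e^z)`. -/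
noncomputable def fulcrumC (a : ℕ → ℝ) (z : ℂ) : ℂ := Complex.log (fsumC a (Complex.exp z))

end KhinchinPaper

namespace KhinchinPaper

section Combinatorics

/-- Exponent vectors `m` on `{0, …, N}` with `m 0 = m 1 = 0` and weight `∑ j * m j = k`. -/
def weightTuples (N k : ℕ) : Finset (Fin (N + 1) → ℕ) :=
  (Fintype.piFinset fun _ : Fin (N + 1) => Finset.range (N + 1)).filter
    fun m => m 0 = 0 ∧ m 1 = 0 ∧ ∑ j : Fin (N + 1), (j : ℕ) * m j = k

/-- The part of degree `k` of `exp (∑ j ≥ 2, x j * X ^ j)`, where `j` runs up to `N`. -/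
noncomputable def weightSum (x : ℕ → ℝ) (N k : ℕ) : ℝ :=
  ∑ m ∈ weightTuples N k, ∏ j : Fin (N + 1), x j ^ m j / (Nat.factorial (m j) : ℝ)

lemma mem_weightTuples {N k : ℕ} (hk : k ≤ N) {m : Fin (N + 1) → ℕ} :
    m ∈ weightTuples N k ↔ m 0 = 0 ∧ m 1 = 0 ∧ ∑ j : Fin (N + 1), (j : ℕ) * m j = k := by
  simp only [weightTuples, Finset.mem_filter, Fintype.mem_piFinset, Finset.mem_range,
    and_iff_right_iff_imp]
  rintro ⟨h0, -, h⟩ j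
  rcases eq_or_ne j 0 with rfl | hj
  · omega
  · have h1 := Finset.single_le_sum (f := fun j : Fin (N + 1) => (j : ℕ) * m j)
      (fun _ _ => Nat.zero_le _) (Finset.mem_univ j)
    have h2 : 0 < (j : ℕ) := Nat.pos_of_ne_zero fun h => hj (Fin.ext h)
    have h3 : m j ≤ j * m j := Nat.le_mul_of_pos_left _ h2
    omega

lemma sum_mul_add_single {N : ℕ} (m : Fin (N + 1) → ℕ) (j : Fin (N + 1)) :
    ∑ i : Fin (N + 1), (i : ℕ) * (m + Pi.single j 1 : Fin (N + 1) → ℕ) i =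
      ∑ i : Fin (N + 1), (i : ℕ) * m i + j := by
  simp [mul_add, Finset.sum_add_distrib, Pi.single_apply]

lemma prod_add_single {N : ℕ} (x : ℕ → ℝ) (m : Fin (N + 1) → ℕ) (j : Fin (N + 1)) :
    ((m + Pi.single j 1 : Fin (N + 1) → ℕ) j : ℝ) * ∏ i : Fin (N + 1),
        x i ^ (m + Pi.single j 1 : Fin (N + 1) → ℕ) i / (Nat.factorial ((m + Pi.single j 1 : Fin (N + 1) → ℕ) i) : ℝ) =
      x j * ∏ i : Fin (N + 1), x i ^ m i / (Nat.factorial (m i) : ℝ) := by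
  rw [← Finset.mul_prod_erase _ _ (Finset.mem_univ j), ← Finset.mul_prod_erase Finset.univ
    (fun i : Fin (N + 1) => x i ^ m i / (Nat.factorial (m i) : ℝ)) (Finset.mem_univ j)]
  have h : ∏ i ∈ Finset.univ.erase j,
        x (i : Fin (N + 1)) ^ (m + Pi.single j 1 : Fin (N + 1) → ℕ) i /
          (Nat.factorial ((m + Pi.single j 1 : Fin (N + 1) → ℕ) i) : ℝ) =
      ∏ i ∈ Finset.univ.erase j, x i ^ m i / (Nat.factorial (m i) : ℝ) := by
    refine Finset.prod_congr rfl fun i hi => ?_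
    simp [Finset.ne_of_mem_erase hi]
  rw [h]
  simp only [Pi.add_apply, Pi.single_eq_same, Nat.factorial_succ]
  push_cast
  have := Nat.factorial_ne_zero (m j)
  field_simp
  ring

lemma sum_mul_prod_weightTuples (x : ℕ → ℝ) {N k : ℕ} (hk : k ≤ N) (j : Fin (N + 1)) :
    ∑ m ∈ weightTuples N k, (m j : ℝ) *
        ∏ i : Fin (N + 1), x i ^ m i / (Nat.factorial (m i) : ℝ) =
      if 2 ≤ (j : ℕ) ∧ (j : ℕ) ≤ k then x j * weightSum x N (k - j) else 0 := by
  have hzero : ∀ m ∈ weightTuples N k, ¬(2 ≤ (j : ℕ) ∧ (j : ℕ) ≤ k) → m j = 0 := by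
    intro m hm hj
    obtain ⟨h0, h1, h⟩ := (mem_weightTuples hk).1 hm
    by_cases hj2 : 2 ≤ (j : ℕ)
    · have h2 := Finset.single_le_sum (f := fun j : Fin (N + 1) => (j : ℕ) * m j)
        (fun _ _ => Nat.zero_le _) (Finset.mem_univ j)
      by_contra hne
      have h3 : (j : ℕ) ≤ j * m j := Nat.le_mul_of_pos_right _ (Nat.pos_of_ne_zero hne)
      omega
    · have : j = 0 ∨ j = 1 := by
        rcases N with _ | N
        · exact Or.inl (Fin.ext (by omega))
        · simp only [Fin.ext_iff, Fin.val_zero, Fin.val_one]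
          omega
      rcases this with rfl | rfl <;> assumption
  split_ifs with hj
  · rw [weightSum, Finset.mul_sum, ← Finset.sum_filter_of_ne (p := fun m => m j ≠ 0)]
    · symm
      have hne : ∀ i : Fin (N + 1), (i : ℕ) < 2 → i ≠ j := by
        rintro i hi rfl
        omega
      have h0j : (0 : Fin (N + 1)) ≠ j := hne _ (by simp)
      have h1j : (1 : Fin (N + 1)) ≠ j := hne _ (by
        rw [Fin.val_one']
        exact lt_of_le_of_lt (Nat.mod_le _ _) one_lt_two)
      have hsub : ∀ m : Fin (N + 1) → ℕ, m j ≠ 0 → m - Pi.single j 1 + Pi.single j 1 = m := by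
        intro m hm
        refine tsub_add_cancel_of_le fun i => ?_
        rcases eq_or_ne i j with rfl | hi
        · simpa using Nat.one_le_iff_ne_zero.2 hm
        · simp [hi]
      refine Finset.sum_nbij' (fun m => m + Pi.single j 1) (fun m => m - Pi.single j 1)
        ?_ ?_ ?_ ?_ ?_
      · intro m hm
        obtain ⟨h0, h1, h⟩ := (mem_weightTuples (by omega)).1 hm
        rw [Finset.mem_filter, mem_weightTuples hk, sum_mul_add_single, h]
        refine ⟨⟨by simp [h0, h0j], by simp [h1, h1j], by omega⟩, by simp⟩
      · intro m hm
        rw [Finset.mem_filter, mem_weightTuples hk] at hm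
        obtain ⟨⟨h0, h1, h⟩, hm⟩ := hm
        rw [mem_weightTuples (by omega)]
        refine ⟨by simp [h0], by simp [h1], ?_⟩
        rw [← hsub m hm, sum_mul_add_single] at h
        omega
      · intro m _
        simp
      · intro m hm
        exact hsub m (Finset.mem_filter.1 hm).2
      · intro m _
        exact (prod_add_single x m j).symm
    · intro m _ hm h
      simp [h] at hm
  · refine Finset.sum_eq_zero fun m hm => ?_
    rw [hzero m hm hj, Nat.cast_zero, zero_mul]

lemma mul_weightSum (x : ℕ → ℝ) {N k : ℕ} (hk : k ≤ N) :
    (k : ℝ) * weightSum x N k = ∑ j : Fin (N + 1),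
      if 2 ≤ (j : ℕ) ∧ (j : ℕ) ≤ k then (j : ℝ) * x j * weightSum x N (k - j) else 0 := by
  have h : (k : ℝ) * weightSum x N k = ∑ m ∈ weightTuples N k, ∑ j : Fin (N + 1),
      (j : ℝ) * ((m j : ℝ) * ∏ i : Fin (N + 1), x i ^ m i / (Nat.factorial (m i) : ℝ)) := by
    rw [weightSum, Finset.mul_sum]
    refine Finset.sum_congr rfl fun m hm => ?_
    have h := ((mem_weightTuples hk).1 hm).2.2
    rw [← h]
    push_cast
    rw [Finset.sum_mul]
    simp only [mul_assoc]
  rw [h, Finset.sum_comm]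
  refine Finset.sum_congr rfl fun j _ => ?_
  rw [← Finset.mul_sum, sum_mul_prod_weightTuples x hk, mul_ite, mul_zero, mul_assoc]

lemma succ_mul_weightSum {x : ℕ → ℝ} (hx : x 1 = 0) {N k : ℕ} (hk : k + 1 ≤ N) :
    ((k : ℝ) + 1) * weightSum x N (k + 1) =
      ∑ i ∈ Finset.range (k + 1), ((i : ℝ) + 1) * x (i + 1) * weightSum x N (k - i) := by
  have h := mul_weightSum x hk
  push_cast at h
  rw [h, Fin.sum_univ_eq_sum_range (fun j : ℕ => if 2 ≤ j ∧ j ≤ k + 1 then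
    (j : ℝ) * x j * weightSum x N (k + 1 - j) else 0), ← Finset.sum_subset
    (Finset.range_mono (show k + 2 ≤ N + 1 by omega)), Finset.sum_range_succ']
  · rw [if_neg (by omega), add_zero]
    refine Finset.sum_congr rfl fun i hi => ?_
    rw [Finset.mem_range] at hi
    rcases Nat.eq_zero_or_pos i with rfl | hi0
    · simp [hx]
    · rw [if_pos (by omega), Nat.add_sub_add_right]
      push_cast
      rfl
  · intro j _ hj
    rw [Finset.mem_range] at hj
    exact if_neg (by omega)

lemma weightSum_zero (x : ℕ → ℝ) (N : ℕ) : weightSum x N 0 = 1 := by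
  have h : weightTuples N 0 = {0} := by
    ext m
    rw [mem_weightTuples (Nat.zero_le _), Finset.mem_singleton]
    constructor
    · rintro ⟨h0, -, h⟩
      funext j
      rcases eq_or_ne j 0 with rfl | hj
      · exact h0
      · have := (Finset.sum_eq_zero_iff.1 h) j (Finset.mem_univ j)
        exact (mul_eq_zero.1 this).resolve_left fun h => hj (Fin.ext h)
    · rintro rfl
      simp
  simp [weightSum, h]

/-- `weightSum` is the only solution of the recursion for the coefficients of an exponential. -/
lemma eq_weightSum {x M : ℕ → ℝ} (hx : x 1 = 0) (hM0 : M 0 = 1)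
    (hM : ∀ k : ℕ, ((k : ℝ) + 1) * M (k + 1) =
      ∑ i ∈ Finset.range (k + 1), ((i : ℝ) + 1) * x (i + 1) * M (k - i))
    {N k : ℕ} (hk : k ≤ N) : M k = weightSum x N k := by
  induction k using Nat.strong_induction_on with
  | _ k ih =>
    rcases k with _ | k
    · rw [hM0, weightSum_zero]
    · have hne : (k : ℝ) + 1 ≠ 0 := by positivity
      refine mul_left_cancel₀ hne ?_
      rw [hM, succ_mul_weightSum hx hk]
      refine Finset.sum_congr rfl fun i _ => ?_
      rw [ih (k - i) (by omega) (by omega)]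

end Combinatorics

section Analysis

open MeasureTheory ProbabilityTheory

variable {a : ℕ → ℝ} {R s c : ℝ}

/-- The measure on `ℕ` with mass `a n` at `n`. -/
noncomputable def coeffMeasure (a : ℕ → ℝ) : Measure ℕ :=
  Measure.sum fun n => ENNReal.ofReal (a n) • Measure.dirac n

lemma integrable_coeffMeasure (ha : ∀ n, 0 ≤ a n) {g : ℕ → ℝ} :
    Integrable g (coeffMeasure a) ↔ Summable fun n => a n * |g n| := by
  rw [coeffMeasure, integrable_sum_dirac_iff fun _ => ENNReal.ofReal_ne_top]
  simp [ha]

lemma integral_coeffMeasure (ha : ∀ n, 0 ≤ a n) (g : ℕ → ℝ) :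
    ∫ n, g n ∂coeffMeasure a = ∑' n, a n * g n := by
  rw [coeffMeasure, integral_sum_dirac fun _ => ENNReal.ofReal_ne_top]
  simp [ha]

lemma exp_mul_sub (u c : ℝ) (n : ℕ) :
    Real.exp (u * ((n : ℝ) - c)) = Real.exp u ^ n * Real.exp (-(u * c)) := by
  rw [← Real.exp_nat_mul, ← Real.exp_add]
  ring_nf

lemma mem_interior_integrableExpSet (hK : IsK a R) (hs : Real.exp s < R) :
    s ∈ interior (integrableExpSet (fun n : ℕ => (n : ℝ) - c) (coeffMeasure a)) := by
  have hsub : {u | Real.exp u < R} ⊆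
      integrableExpSet (fun n : ℕ => (n : ℝ) - c) (coeffMeasure a) := by
    intro u hu
    rw [integrableExpSet, Set.mem_ofPred_eq, integrable_coeffMeasure hK.nonneg]
    simp only [Real.abs_exp]
    simp only [exp_mul_sub, ← mul_assoc]
    exact (hK.conv _ (Real.exp_pos u).le hu).mul_right _
  exact interior_maximal hsub (isOpen_lt Real.continuous_exp continuous_const) hs

lemma mgf_coeffMeasure (ha : ∀ n, 0 ≤ a n) (u : ℝ) :
    mgf (fun n : ℕ => (n : ℝ) - c) (coeffMeasure a) u =
      fsum a (Real.exp u) * Real.exp (-(u * c)) := by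
  rw [mgf, integral_coeffMeasure ha, fsum, ← tsum_mul_right]
  simp only [exp_mul_sub, mul_assoc]

lemma fsum_pos (hK : IsK a R) {t : ℝ} (ht : 0 ≤ t) (htR : t < R) : 0 < fsum a t :=
  (hK.conv t ht htR).tsum_pos (fun n => mul_nonneg (hK.nonneg n) (pow_nonneg ht n)) 0
    (by simpa using hK.pos₀)

lemma summable_pow_mul (hK : IsK a R) (hs : Real.exp s < R) (k : ℕ) :
    Summable fun n : ℕ => (n : ℝ) ^ k * a n * Real.exp s ^ n := by
  have h := integrable_pow_mul_exp_of_mem_interior_integrableExpSet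
    (mem_interior_integrableExpSet (c := 0) hK hs) k
  rw [integrable_coeffMeasure hK.nonneg] at h
  refine h.congr fun n => ?_
  rw [exp_mul_sub]
  simp only [sub_zero, mul_zero, neg_zero, Real.exp_zero, mul_one]
  rw [abs_of_nonneg (by positivity)]
  ring

lemma iteratedDeriv_mgf_coeffMeasure (hK : IsK a R) (hs : Real.exp s < R) (k : ℕ) :
    iteratedDeriv k (mgf (fun n : ℕ => (n : ℝ) - mf a (Real.exp s)) (coeffMeasure a)) s =
      fsum a (Real.exp s) * Real.exp (-(s * mf a (Real.exp s))) *
        centralMoment a (Real.exp s) k := by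
  have hf := (fsum_pos hK (Real.exp_pos s).le hs).ne'
  rw [iteratedDeriv_mgf (mem_interior_integrableExpSet hK hs), integral_coeffMeasure hK.nonneg,
    centralMoment, ← tsum_mul_left]
  refine tsum_congr fun n => ?_
  rw [exp_mul_sub]
  field_simp

lemma centralMoment_zero (hK : IsK a R) (hs : Real.exp s < R) :
    centralMoment a (Real.exp s) 0 = 1 := by
  have hf := (fsum_pos hK (Real.exp_pos s).le hs).ne'
  simp only [centralMoment, pow_zero, mul_one, tsum_div_const]
  exact div_self hf

lemma centralMoment_one (hK : IsK a R) (hs : Real.exp s < R) :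
    centralMoment a (Real.exp s) 1 = 0 := by
  have hf := (fsum_pos hK (Real.exp_pos s).le hs).ne'
  have h0 : HasSum _ (fsum a (Real.exp s)) := (hK.conv _ (Real.exp_pos s).le hs).hasSum
  have h1 := (summable_pow_mul hK hs 1).hasSum
  simp only [pow_one] at h1
  have h := (h1.sub (h0.mul_left (mf a (Real.exp s)))).div_const (fsum a (Real.exp s))
  rw [centralMoment]
  convert! h.tsum_eq using 1
  · refine tsum_congr fun n => ?_
    ring
  · rw [mf]
    field_simp
    simp

lemma centralMoment_two (hK : IsK a R) (hs : Real.exp s < R) :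
    centralMoment a (Real.exp s) 2 = sigma2 a (Real.exp s) := by
  have hf := (fsum_pos hK (Real.exp_pos s).le hs).ne'
  have h0 : HasSum _ (fsum a (Real.exp s)) := (hK.conv _ (Real.exp_pos s).le hs).hasSum
  have h1 := (summable_pow_mul hK hs 1).hasSum
  have h2 := (summable_pow_mul hK hs 2).hasSum
  simp only [pow_one] at h1
  have h := ((h2.sub (h1.mul_left (2 * mf a (Real.exp s)))).add
    (h0.mul_left (mf a (Real.exp s) ^ 2))).div_const (fsum a (Real.exp s))
  rw [centralMoment]
  convert! h.tsum_eq using 1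
  · refine tsum_congr fun n => ?_
    ring
  · rw [sigma2, mf]
    field_simp
    ring

lemma sigma2_nonneg (hK : IsK a R) (hs : Real.exp s < R) : 0 ≤ sigma2 a (Real.exp s) := by
  rw [← centralMoment_two hK hs]
  have hf := fsum_pos hK (Real.exp_pos s).le hs
  refine tsum_nonneg fun n => ?_
  have := hK.nonneg n
  positivity

lemma normMoment_eq_div (a : ℕ → ℝ) (t : ℝ) (k : ℕ) :
    normMoment a t k = centralMoment a t k / sigma a t ^ k := by
  simp only [normMoment, centralMoment, div_pow, ← mul_div_assoc, tsum_div_const]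

lemma analyticAt_fulcrum (hK : IsK a R) (hs : Real.exp s < R) :
    AnalyticAt ℝ (fulcrum a) s := by
  have h := analyticAt_mgf (mem_interior_integrableExpSet (c := 0) hK hs)
  have he : mgf (fun n : ℕ => (n : ℝ) - 0) (coeffMeasure a) = fun u => fsum a (Real.exp u) := by
    funext u
    rw [mgf_coeffMeasure hK.nonneg]
    simp
  rw [he] at h
  exact h.log (fsum_pos hK (Real.exp_pos s).le hs)

/-- Subtracting a linear function from the fulcrum changes only its first derivative. -/
lemma iteratedDeriv_deriv_fulcrum_sub (hK : IsK a R) (hs : Real.exp s < R) (c : ℝ) (i : ℕ) :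
    iteratedDeriv i (fun u => deriv (fulcrum a) u - c) s =
      iteratedDeriv (i + 1) (fulcrum a) s - if i = 0 then c else 0 := by
  rw [iteratedDeriv_fun_sub (analyticAt_fulcrum hK hs).deriv.contDiffAt contDiffAt_const,
    iteratedDeriv_const, iteratedDeriv_succ']

lemma deriv_mgf_coeffMeasure (hK : IsK a R) (hs : Real.exp s < R) :
    deriv (mgf (fun n : ℕ => (n : ℝ) - c) (coeffMeasure a)) s =
      (deriv (fulcrum a) s - c) * mgf (fun n : ℕ => (n : ℝ) - c) (coeffMeasure a) s := by
  have he : mgf (fun n : ℕ => (n : ℝ) - c) (coeffMeasure a) =ᶠ[𝓝 s]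
      fun u => Real.exp (fulcrum a u - u * c) := by
    filter_upwards [(isOpen_lt Real.continuous_exp continuous_const).mem_nhds hs] with u hu
    rw [mgf_coeffMeasure hK.nonneg, sub_eq_add_neg, Real.exp_add, fulcrum,
      Real.exp_log (fsum_pos hK (Real.exp_pos u).le hu)]
  have hd := ((analyticAt_fulcrum hK hs).differentiableAt.hasDerivAt.sub
    ((hasDerivAt_id s).mul_const c)).exp
  rw [he.deriv_eq, he.eq_of_nhds]
  refine hd.deriv.trans ?_
  simp [mul_comm]

/-- Differentiating `G' = (F' - m) G`, where `G` is the exponential generating function of the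
central moments. -/
lemma centralMoment_succ (hK : IsK a R) (hs : Real.exp s < R) (k : ℕ) :
    centralMoment a (Real.exp s) (k + 1) = ∑ i ∈ Finset.range (k + 1), (k.choose i : ℝ) *
      (iteratedDeriv (i + 1) (fulcrum a) s - if i = 0 then mf a (Real.exp s) else 0) *
        centralMoment a (Real.exp s) (k - i) := by
  set c := mf a (Real.exp s) with hc
  set G := mgf (fun n : ℕ => (n : ℝ) - c) (coeffMeasure a) with hG
  have hf := (fsum_pos hK (Real.exp_pos s).le hs).ne'
  have he : deriv G =ᶠ[𝓝 s] (fun u => deriv (fulcrum a) u - c) * G := by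
    filter_upwards [(isOpen_lt Real.continuous_exp continuous_const).mem_nhds hs] with u hu
    exact deriv_mgf_coeffMeasure hK hu
  have h := he.iteratedDeriv_eq k
  rw [← iteratedDeriv_succ', iteratedDeriv_mul
    ((analyticAt_fulcrum hK hs).deriv.contDiffAt.sub contDiffAt_const)
    (analyticAt_mgf (mem_interior_integrableExpSet hK hs)).contDiffAt] at h
  simp only [hG, hc, iteratedDeriv_mgf_coeffMeasure hK hs,
    iteratedDeriv_deriv_fulcrum_sub hK hs] at h
  refine mul_left_cancel₀ (mul_ne_zero hf (Real.exp_pos (-(s * c))).ne') ?_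
  rw [h, Finset.mul_sum]
  refine Finset.sum_congr rfl fun i _ => ?_
  ring

lemma deriv_fulcrum (hK : IsK a R) (hs : Real.exp s < R) :
    iteratedDeriv 1 (fulcrum a) s = mf a (Real.exp s) := by
  have h := centralMoment_succ hK hs 0
  rw [zero_add, centralMoment_one hK hs] at h
  simp only [zero_add, Finset.range_one, Finset.sum_singleton, centralMoment_zero hK hs,
    if_true, Nat.choose_self, Nat.cast_one, one_mul, mul_one, Nat.sub_self] at h
  linarith

lemma iteratedDeriv_two_fulcrum (hK : IsK a R) (hs : Real.exp s < R) :
    iteratedDeriv 2 (fulcrum a) s = sigma2 a (Real.exp s) := by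
  have h := centralMoment_succ hK hs 1
  rw [centralMoment_two hK hs] at h
  simp [Finset.sum_range_succ, centralMoment_zero hK hs, centralMoment_one hK hs] at h
  exact h.symm

/-- The central moments in terms of the derivatives of the fulcrum. -/
lemma centralMoment_eq_weightSum (hK : IsK a R) (hs : Real.exp s < R) (n : ℕ) :
    centralMoment a (Real.exp s) n = (Nat.factorial n : ℝ) *
      weightSum (fun j => (iteratedDeriv j (fulcrum a) s -
        if j = 1 then mf a (Real.exp s) else 0) / (Nat.factorial j : ℝ)) n n := by
  rw [← eq_weightSum (M := fun k => centralMoment a (Real.exp s) k / (Nat.factorial k : ℝ))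
    (by simp [deriv_fulcrum hK hs]) (by simp [centralMoment_zero hK hs]) ?_ le_rfl]
  · have := Nat.factorial_ne_zero n
    field_simp
  · intro k
    rw [centralMoment_succ hK hs, Finset.sum_div, Finset.mul_sum]
    refine Finset.sum_congr rfl fun i hi => ?_
    rw [Nat.cast_choose ℝ (Finset.mem_range_succ_iff.1 hi)]
    simp only [Nat.factorial_succ, Nat.add_eq_right]
    push_cast
    have h1 := Nat.factorial_ne_zero k
    have h2 := Nat.factorial_ne_zero i
    have h3 := Nat.factorial_ne_zero (k - i)
    field_simp

lemma sigma2_rpow (hK : IsK a R) (hs : Real.exp s < R) (j : ℕ) :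
    sigma2 a (Real.exp s) ^ ((j : ℝ) / 2) = sigma a (Real.exp s) ^ j := by
  rw [sigma, Real.sqrt_eq_rpow, ← Real.rpow_natCast, ← Real.rpow_mul (sigma2_nonneg hK hs)]
  ring_nf

end Analysis

/-- moments of the normalized family in terms of the fulcrum. -/
theorem statement1 (a : ℕ → ℝ) (R : ℝ) (hK : IsK a R) (s : ℝ) (hs : Real.exp s < R)
    (n : ℕ) (hn : 3 ≤ n) :
    normMoment a (Real.exp s) n =
      ∑ m ∈ tuples n,
        ((Nat.factorial n : ℝ) / ∏ j : Fin (n + 1), (Nat.factorial (m j) : ℝ)) *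
          ∏ j : Fin (n + 1),
            (iteratedDeriv (j : ℕ) (fulcrum a) s /
              ((iteratedDeriv 2 (fulcrum a) s) ^ (((j : ℕ) : ℝ) / 2) *
                (Nat.factorial (j : ℕ) : ℝ))) ^ (m j) := by
  rw [normMoment_eq_div, centralMoment_eq_weightSum hK hs, weightSum, Finset.mul_sum,
    Finset.sum_div]
  refine Finset.sum_congr rfl fun m hm => ?_
  obtain ⟨-, h1, h⟩ := (mem_weightTuples le_rfl).1 hm
  have hσ : sigma a (Real.exp s) ^ n =
      ∏ j : Fin (n + 1), (sigma a (Real.exp s) ^ (j : ℕ)) ^ m j := by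
    conv_lhs => rw [← h]
    simp only [← pow_mul, Finset.prod_pow_eq_pow_sum]
  rw [mul_div_assoc, hσ, ← Finset.prod_div_distrib, div_mul_eq_mul_div, mul_div_assoc,
    ← Finset.prod_div_distrib]
  congr 1
  refine Finset.prod_congr rfl fun j _ => ?_
  rw [iteratedDeriv_two_fulcrum hK hs, sigma2_rpow hK hs]
  by_cases hj : (j : ℕ) = 1
  · have hj1 : j = 1 := by
      apply Fin.ext
      rw [hj, Fin.val_one', Nat.mod_eq_of_lt (by omega)]
    simp [hj1, h1]
  · simp only [hj, if_false, sub_zero, div_pow, mul_pow]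
    simp only [div_eq_mul_inv, mul_inv]
    ring

end KhinchinPaper
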